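/- Let H be one of the following coloured graphs: a b-path, a br-path, a brb-path, a brr-path, or a brrb-path. Then for every n with 7 ≤ n ≤ 13, Builder has a winning strategy in RR(C4, Pn, H). Furthermore, for every n with 8 ≤ n ≤ 13, Builder has a winning strategy in RR(C4, Pn, ∅), the game starting from the empty coloured graph. -/

import Mathlib

/-!
The game `RR(C₄, Pₙ, H)`: the board is `K_ℕ` on which a coloured graph `H`
(with red edge set `R₀` and blue edge set `B₀`) is initially placed.  In each
round Builder selects a previously uncoloured edge and Painter colours it red
(`true`) or blue (`false`), except that Painter may never colour an edge red
if the red edges would then contain a `C₄`.  Builder wins if `e(H) ≤ 2n - 2`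
and after at most `2n - 2 - e(H)` rounds the blue edges number exactly `n - 1`
and contain a path on `n` vertices.
-/

namespace OnlineRamsey

abbrev Edge := Sym2 ℕ
abbrev History := List (Edge × Bool)   -- `true` = red, `false` = blue
abbrev BuilderStrat := History → Edge
abbrev PainterStrat := History → Edge → Bool

/-- The history of coloured edges after `t` rounds (not counting the initial
coloured graph), when Builder follows `B` and Painter follows `P`. -/
def gamePlay (B : BuilderStrat) (P : PainterStrat) : ℕ → History
  | 0 => []
  | t + 1 =>
      let h := gamePlay B P t
      h ++ [(B h, P h (B h))]

/-- All red edges: the initially placed ones together with those coloured red. -/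
def redSet (R₀ : Set Edge) (h : History) : Set Edge := R₀ ∪ {e | (e, true) ∈ h}

/-- All blue edges: the initially placed ones together with those coloured blue. -/
def blueSet (B₀ : Set Edge) (h : History) : Set Edge := B₀ ∪ {e | (e, false) ∈ h}

/-- `H` contains a copy of `G`. -/
def HasCopy {α β : Type} (G : SimpleGraph α) (H : SimpleGraph β) : Prop :=
  ∃ f : G →g H, Function.Injective f

/-- Painter never colours an edge red if the red edges would then contain a `C₄`. -/
def PainterLegal (R₀ : Set Edge) (P : PainterStrat) : Prop :=
  ∀ (h : History) (e : Edge), P h e = true →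
    ¬ HasCopy (SimpleGraph.cycleGraph 4)
        (SimpleGraph.fromEdgeSet (insert e (redSet R₀ h)))

/-- During the first `m` rounds Builder always selects a previously uncoloured
(non-loop) edge. -/
def BuilderLegal (R₀ B₀ : Set Edge) (B : BuilderStrat) (m : ℕ) : Prop :=
  ∀ P : PainterStrat, ∀ t < m,
    ¬ (B (gamePlay B P t)).IsDiag ∧
      B (gamePlay B P t) ∉ redSet R₀ (gamePlay B P t) ∪ blueSet B₀ (gamePlay B P t)

/-- Builder has a winning strategy in the game `RR(C₄, Pₙ, H)`, where the initial
coloured graph `H` has red edge set `R₀` and blue edge set `B₀`. -/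
def RRWin (n : ℕ) (R₀ B₀ : Set Edge) : Prop :=
  (R₀ ∪ B₀).ncard ≤ 2 * n - 2 ∧
  ∃ B : BuilderStrat, BuilderLegal R₀ B₀ B (2 * n - 2 - (R₀ ∪ B₀).ncard) ∧
    ∀ P : PainterStrat, PainterLegal R₀ P →
      ∃ t ≤ 2 * n - 2 - (R₀ ∪ B₀).ncard,
        (blueSet B₀ (gamePlay B P t)).ncard = n - 1 ∧
        HasCopy (SimpleGraph.pathGraph n)
          (SimpleGraph.fromEdgeSet (blueSet B₀ (gamePlay B P t)))

/-! ### From a combinatorial winning predicate to a strategy -/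

/-- `CW n k R B`: Builder can force a win within `k` further rounds from the position with red
edges `R` and blue edges `B`. -/
inductive CW (n : ℕ) : ℕ → Set Edge → Set Edge → Prop
  | done (k : ℕ) (R B : Set Edge) : B.ncard = n - 1 →
      HasCopy (SimpleGraph.pathGraph n) (SimpleGraph.fromEdgeSet B) → CW n k R B
  | step (k : ℕ) (R B : Set Edge) (e : Edge) : ¬ e.IsDiag → e ∉ R ∪ B →
      CW n k R (insert e B) →
      (¬ HasCopy (SimpleGraph.cycleGraph 4) (SimpleGraph.fromEdgeSet (insert e R)) →
        CW n k (insert e R) B) → CW n (k + 1) R B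

theorem redSet_snoc_true (R₀ : Set Edge) (h : History) (e : Edge) :
    redSet R₀ (h ++ [(e, true)]) = insert e (redSet R₀ h) := by
  ext x; simp [redSet]; tauto

theorem redSet_snoc_false (R₀ : Set Edge) (h : History) (e : Edge) :
    redSet R₀ (h ++ [(e, false)]) = redSet R₀ h := by
  ext x; simp [redSet]

theorem blueSet_snoc_false (R₀ : Set Edge) (h : History) (e : Edge) :
    blueSet R₀ (h ++ [(e, false)]) = insert e (blueSet R₀ h) := by
  ext x; simp [blueSet]; tauto

theorem blueSet_snoc_true (R₀ : Set Edge) (h : History) (e : Edge) :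
    blueSet R₀ (h ++ [(e, true)]) = blueSet R₀ h := by
  ext x; simp [blueSet]

theorem gamePlay_length (B : BuilderStrat) (P : PainterStrat) (t : ℕ) :
    (gamePlay B P t).length = t := by
  induction t with
  | zero => rfl
  | succ t ih => simp [gamePlay, ih]

theorem finite_hist (h : History) (b : Bool) : {e : Edge | (e, b) ∈ h}.Finite := by
  have : {e : Edge | (e, b) ∈ h} ⊆ ↑(h.map Prod.fst).toFinset := by
    intro e he
    simp only [Set.mem_ofPred_eq] at he
    simp only [List.coe_toFinset, Set.mem_ofPred_eq, List.mem_map]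
    exact ⟨_, he, rfl⟩
  exact (Finset.finite_toSet _).subset this

theorem exists_legal {X : Set Edge} (hX : X.Finite) : ∃ e : Edge, ¬ e.IsDiag ∧ e ∉ X := by
  have hinf : (Set.range (fun i : ℕ => (s(0, i + 1) : Edge))).Infinite := by
    apply Set.infinite_range_of_injective
    intro i j hij
    simpa using hij
  obtain ⟨e, ⟨i, rfl⟩, he⟩ := (hinf.sdiff hX).nonempty
  exact ⟨_, by simp, he⟩

/-- A move that keeps the position winning. -/
def Good (n m : ℕ) (R B : Set Edge) (len : ℕ) (e : Edge) : Prop :=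
  ¬ e.IsDiag ∧ e ∉ R ∪ B ∧ ∃ k, m = len + (k + 1) ∧ CW n k R (insert e B) ∧
    (¬ HasCopy (SimpleGraph.cycleGraph 4) (SimpleGraph.fromEdgeSet (insert e R)) →
        CW n k (insert e R) B)

open Classical in
theorem rrwin_of_CW {n : ℕ} {R₀ B₀ : Set Edge} (hR : R₀.Finite) (hB : B₀.Finite)
    (hc : (R₀ ∪ B₀).ncard ≤ 2 * n - 2)
    (hw : CW n (2 * n - 2 - (R₀ ∪ B₀).ncard) R₀ B₀) : RRWin n R₀ B₀ := by
  refine ⟨hc, ?_⟩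
  generalize 2 * n - 2 - (R₀ ∪ B₀).ncard = m at hw ⊢
  have hleg : ∀ h : History, ∃ e : Edge, ¬ e.IsDiag ∧ e ∉ redSet R₀ h ∪ blueSet B₀ h :=
    fun h => exists_legal ((hR.union (finite_hist h true)).union (hB.union (finite_hist h false)))
  have hstrat : ∃ S : BuilderStrat, ∀ h,
      (¬ (S h).IsDiag ∧ S h ∉ redSet R₀ h ∪ blueSet B₀ h) ∧
      ((∃ e, Good n m (redSet R₀ h) (blueSet B₀ h) h.length e) →
        Good n m (redSet R₀ h) (blueSet B₀ h) h.length (S h)) := by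
    have : ∀ h : History, ∃ e : Edge, (¬ e.IsDiag ∧ e ∉ redSet R₀ h ∪ blueSet B₀ h) ∧
        ((∃ e, Good n m (redSet R₀ h) (blueSet B₀ h) h.length e) →
        Good n m (redSet R₀ h) (blueSet B₀ h) h.length e) := by
      intro h
      by_cases hg : ∃ e, Good n m (redSet R₀ h) (blueSet B₀ h) h.length e
      · obtain ⟨e, he⟩ := hg
        exact ⟨e, ⟨he.1, he.2.1⟩, fun _ => he⟩
      · obtain ⟨e, he⟩ := hleg h
        exact ⟨e, he, fun h' => absurd h' hg⟩
    choose S hS using this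
    exact ⟨S, hS⟩
  obtain ⟨S, hS⟩ := hstrat
  refine ⟨S, fun P t _ => (hS _).1, fun P hP => ?_⟩
  have key : ∀ t ≤ m, (∃ t' ≤ m, (blueSet B₀ (gamePlay S P t')).ncard = n - 1 ∧
        HasCopy (SimpleGraph.pathGraph n)
          (SimpleGraph.fromEdgeSet (blueSet B₀ (gamePlay S P t')))) ∨
      CW n (m - t) (redSet R₀ (gamePlay S P t)) (blueSet B₀ (gamePlay S P t)) := by
    intro t
    induction t with
    | zero =>
      intro _
      right
      simpa [gamePlay, redSet, blueSet] using hw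
    | succ t ih =>
      intro ht
      rcases ih (by omega) with h | h
      · exact Or.inl h
      · obtain ⟨k, hk⟩ : ∃ k, m - t = k + 1 := ⟨m - t - 1, by omega⟩
        have hlen := gamePlay_length S P t
        rw [hk] at h
        have hmk : m - (t + 1) = k := by omega
        rw [hmk]
        generalize hg : gamePlay S P t = g at h hlen
        have hg' : gamePlay S P (t + 1) = g ++ [(S g, P g (S g))] := by
          simp [gamePlay, hg]
        cases h with
        | done _ _ _ h1 h2 => exact Or.inl ⟨t, by omega, by rw [hg]; exact h1, by rw [hg]; exact h2⟩
        | step _ _ _ e h1 h2 h3 h4 =>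
          right
          obtain ⟨-, -, k', hk', hb, hr⟩ := (hS g).2 ⟨e, h1, h2, k, by omega, h3, h4⟩
          have : k' = k := by omega
          subst this
          rw [hg']
          cases hp : P g (S g) with
          | false => rw [redSet_snoc_false, blueSet_snoc_false]; exact hb
          | true =>
            rw [redSet_snoc_true, blueSet_snoc_true]
            exact hr (hP g (S g) hp)
  rcases key m le_rfl with h | h
  · exact h
  · rw [Nat.sub_self] at h
    cases h with
    | done _ _ _ h1 h2 => exact ⟨m, le_rfl, h1, h2⟩

/-! ### Blue linear forests -/

/-- `IsP u v V E`: the edges `E` form a path with vertex set `V` and ends `u`, `v`. -/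
inductive IsP : ℕ → ℕ → Finset ℕ → Finset Edge → Prop
  | single (u : ℕ) : IsP u u {u} ∅
  | join (u v w z : ℕ) (V V' : Finset ℕ) (E E' : Finset Edge) : IsP u v V E → IsP w z V' E' →
      Disjoint V V' → IsP u z (V ∪ V') (insert s(v, w) (E ∪ E'))

theorem IsP.symm {u v : ℕ} {V : Finset ℕ} {E : Finset Edge} (h : IsP u v V E) :
    IsP v u V E := by
  induction h with
  | single u => exact .single u
  | join u v w z V V' E E' _ _ hd ih1 ih2 =>
    have := IsP.join _ _ _ _ _ _ _ _ ih2 ih1 hd.symm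
    rwa [Finset.union_comm V' V, Finset.union_comm E' E, Sym2.eq_swap] at this

theorem IsP.mem {u v : ℕ} {V : Finset ℕ} {E : Finset Edge} (h : IsP u v V E) :
    u ∈ V ∧ v ∈ V := by
  induction h with
  | single u => simp
  | join u v w z V V' E E' _ _ hd ih1 ih2 => simp [ih1, ih2]

theorem IsP.edge {u v : ℕ} {V : Finset ℕ} {E : Finset Edge} (h : IsP u v V E) :
    ∀ a b, s(a, b) ∈ E → a ∈ V ∧ b ∈ V := by
  induction h with
  | single u => simp
  | join u v w z V V' E E' h1 h2 hd ih1 ih2 =>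
    intro a b hab
    have := h1.mem
    have := h2.mem
    simp only [Finset.mem_insert, Finset.mem_union, Sym2.eq_iff] at hab ⊢
    rcases hab with (⟨rfl, rfl⟩ | ⟨rfl, rfl⟩) | hab | hab
    · tauto
    · tauto
    · have := ih1 a b hab; tauto
    · have := ih2 a b hab; tauto

theorem IsP.self {u v : ℕ} {V : Finset ℕ} {E : Finset Edge} (h : IsP u v V E) (huv : u = v) :
    E = ∅ := by
  cases h with
  | single u => rfl
  | join _ v w _ V V' E E' h1 h2 hd =>
    subst huv
    exact absurd h2.mem.2 (Finset.disjoint_left.mp hd h1.mem.1)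

theorem IsP.list {u v : ℕ} {V : Finset ℕ} {E : Finset Edge} (h : IsP u v V E) :
    ∃ L : List ℕ, L.Nodup ∧ (∀ x ∈ L, x ∈ V) ∧ L.length = E.card + 1 ∧
      L.IsChain (fun a b => s(a, b) ∈ E) ∧ u ∈ L.head? ∧ v ∈ L.getLast? := by
  induction h with
  | single u => exact ⟨[u], by simp⟩
  | join u v w z V V' E E' h1 h2 hd ih1 ih2 =>
    obtain ⟨L1, a1, a2, a3, a4, a5, a6⟩ := ih1
    obtain ⟨L2, b1, b2, b3, b4, b5, b6⟩ := ih2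
    refine ⟨L1 ++ L2, ?_, ?_, ?_, ?_, ?_, ?_⟩
    · rw [List.nodup_append']
      exact ⟨a1, b1, fun x hx hx' => Finset.disjoint_left.mp hd (a2 x hx) (b2 x hx')⟩
    · intro x hx
      rw [List.mem_append] at hx
      rw [Finset.mem_union]
      exact hx.imp (a2 x) (b2 x)
    · have hdE : Disjoint E E' := by
        rw [Finset.disjoint_left]
        intro e
        induction e using Sym2.ind with
        | _ a b =>
          intro he he'
          exact Finset.disjoint_left.mp hd (h1.edge _ _ he).1 (h2.edge _ _ he').1
      have hn : s(v, w) ∉ E ∪ E' := by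
        rw [Finset.mem_union]
        rintro (he | he)
        · exact Finset.disjoint_left.mp hd (h1.edge _ _ he).2 h2.mem.1
        · exact Finset.disjoint_left.mp hd h1.mem.2 (h2.edge _ _ he).1
      rw [Finset.card_insert_of_notMem hn, Finset.card_union_of_disjoint hdE, List.length_append]
      omega
    · rw [List.isChain_append]
      refine ⟨a4.imp ?_, b4.imp ?_, ?_⟩
      · intro a b hab; simp [hab]
      · intro a b hab; simp [hab]
      · intro x hx y hy
        have : x = v := by rw [Option.mem_def] at *; rw [a6] at hx; exact (Option.some.inj hx).symm
        have : y = w := by rw [Option.mem_def] at *; rw [b5] at hy; exact (Option.some.inj hy).symm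
        subst x y
        simp
    · simp only [Option.mem_def] at *
      simp [a5]
    · simp only [Option.mem_def] at *
      simp [b6]

theorem IsP.hasCopy {u v n : ℕ} {V : Finset ℕ} {E : Finset Edge} (h : IsP u v V E)
    (hn : E.card + 1 = n) :
    HasCopy (SimpleGraph.pathGraph n) (SimpleGraph.fromEdgeSet (E : Set Edge)) := by
  obtain ⟨L, h1, -, h3, h4, -, -⟩ := h.list
  have hl : L.length = n := by omega
  have hinj : ∀ i j : Fin n, L[i.1]'(by omega) = L[j.1]'(by omega) → i = j := by
    intro i j hij
    exact Fin.ext ((List.Nodup.getElem_inj_iff h1).mp hij)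
  have hch : ∀ i j : Fin n, i.1 + 1 = j.1 →
      s(L[i.1]'(by omega), L[j.1]'(by omega)) ∈ E := by
    intro i j hij
    have := List.isChain_iff_getElem.mp h4 i.1 (by omega)
    simpa [hij] using this
  refine ⟨⟨fun i => L[i.1]'(by omega), ?_⟩, fun i j hij => hinj i j hij⟩
  intro i j hij
  have hne : i ≠ j := hij.ne
  rw [SimpleGraph.fromEdgeSet_adj]
  refine ⟨?_, fun h => hne (hinj i j h)⟩
  rw [SimpleGraph.pathGraph_adj] at hij
  rcases hij with hij | hij
  · exact hch i j hij
  · rw [Sym2.eq_swap]; exact hch j i hij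

/-- `Forest l V E`: the edges `E` form a linear forest on `V` whose components have the end pairs
listed in `l` (an isolated vertex `u` is listed as `(u, u)`). -/
inductive Forest : List (ℕ × ℕ) → Finset ℕ → Finset Edge → Prop
  | nil : Forest [] ∅ ∅
  | cons (p : ℕ × ℕ) (l : List (ℕ × ℕ)) (V V' : Finset ℕ) (E E' : Finset Edge) :
      IsP p.1 p.2 V E → Forest l V' E' → Disjoint V V' → Forest (p :: l) (V ∪ V') (E ∪ E')

theorem Forest.edge {l : List (ℕ × ℕ)} {V : Finset ℕ} {E : Finset Edge} (h : Forest l V E) :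
    ∀ a b, s(a, b) ∈ E → a ∈ V ∧ b ∈ V := by
  induction h with
  | nil => simp
  | cons p l V V' E E' h1 _ _ ih =>
    intro a b hab
    simp only [Finset.mem_union] at hab ⊢
    rcases hab with hab | hab
    · have := h1.edge a b hab; tauto
    · have := ih a b hab; tauto

theorem Forest.perm {l l' : List (ℕ × ℕ)} (hp : l.Perm l') :
    ∀ {V : Finset ℕ} {E : Finset Edge}, Forest l V E → Forest l' V E := by
  induction hp with
  | nil => exact fun h => h
  | cons x _ ih =>
    intro V E h
    cases h with
    | cons _ _ V V' E E' h1 h2 hd => exact .cons _ _ _ _ _ _ h1 (ih h2) hd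
  | swap x y l =>
    intro V E h
    cases h with
    | cons _ _ V V' E E' h1 h2 hd =>
      cases h2 with
      | cons _ _ V1 V2 E1 E2 h3 h4 hd' =>
        rw [Finset.disjoint_union_right] at hd
        have := Forest.cons x _ _ _ _ _ h3 (.cons y _ _ _ _ _ h1 h4 hd.2)
          (Finset.disjoint_union_right.mpr ⟨hd.1.symm, hd'⟩)
        rwa [Finset.union_left_comm V V1, Finset.union_left_comm E E1]
  | trans _ _ ih1 ih2 => exact fun h => ih2 (ih1 h)

theorem Forest.allTriv {l : List (ℕ × ℕ)} {V : Finset ℕ} {E : Finset Edge} (h : Forest l V E)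
    (ht : ∀ p ∈ l, p.1 = p.2) : E = ∅ := by
  induction h with
  | nil => rfl
  | cons p l V V' E E' h1 _ _ ih =>
    rw [h1.self (ht p (by simp)), ih (fun q hq => ht q (by simp [hq]))]
    rfl

/-- Each component in the first list occurs, up to orientation, in the second one, and the rest
of the second list consists of isolated vertices. -/
def matchC : List (ℕ × ℕ) → List (ℕ × ℕ) → Bool
  | [], l => l.all (fun p => p.1 == p.2)
  | c :: t, l =>
      if c ∈ l then matchC t (l.erase c)
      else if c.swap ∈ l then matchC t (l.erase c.swap) else false

theorem Forest.extract {c : ℕ × ℕ} {l : List (ℕ × ℕ)} {V : Finset ℕ} {E : Finset Edge}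
    (h : Forest l V E) (hc : c ∈ l) :
    ∃ V1 V2 E1 E2, IsP c.1 c.2 V1 E1 ∧ Forest (l.erase c) V2 E2 ∧ Disjoint V1 V2 ∧
      V = V1 ∪ V2 ∧ E = E1 ∪ E2 := by
  have := h.perm (List.perm_cons_erase hc)
  cases this with
  | cons _ _ V V' E E' h1 h2 hd => exact ⟨_, _, _, _, h1, h2, hd, rfl, rfl⟩

theorem Forest.of_matchC {l' : List (ℕ × ℕ)} : ∀ {l : List (ℕ × ℕ)} {V : Finset ℕ} {E : Finset Edge}
    (f : ℕ → ℕ), Forest (l.map (Prod.map f f)) V E → matchC l' l = true →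
    ∃ V' ⊆ V, Forest (l'.map (Prod.map f f)) V' E := by
  induction l' with
  | nil =>
    intro l V E f h hm
    refine ⟨∅, by simp, ?_⟩
    rw [h.allTriv ?_]
    · exact .nil
    · intro p hp
      simp only [matchC, List.all_eq_true, beq_iff_eq] at hm
      obtain ⟨q, hq, rfl⟩ := List.mem_map.mp hp
      simp [hm q hq]
  | cons c t ih =>
    intro l V E f h hm
    have main : ∀ d ∈ l, (∀ V1 E1, IsP (f d.1) (f d.2) V1 E1 → IsP (f c.1) (f c.2) V1 E1) →
        matchC t (l.erase d) = true → ∃ V' ⊆ V, Forest ((c :: t).map (Prod.map f f)) V' E := by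
      intro d hd himp hmm
      have h' := h.perm ((List.perm_cons_erase hd).map (Prod.map f f))
      rw [List.map_cons] at h'
      cases h' with
      | cons _ _ V1 V2 E1 E2 h1 h2 hdj =>
        obtain ⟨V', hV', hF⟩ := ih f h2 hmm
        exact ⟨V1 ∪ V', Finset.union_subset_union_right hV',
          .cons (Prod.map f f c) _ _ _ _ _ (himp _ _ h1) hF (hdj.mono_right hV')⟩
    rw [matchC] at hm
    split_ifs at hm with h1 h2
    · exact main c h1 (fun _ _ h => h) hm
    · exact main c.swap h2 (fun _ _ h => h.symm) hm

theorem Forest.join {u v w z : ℕ} {l : List (ℕ × ℕ)} {V : Finset ℕ} {E : Finset Edge}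
    (h : Forest ((u, v) :: (w, z) :: l) V E) :
    v ≠ w ∧ s(v, w) ∉ E ∧ Forest ((u, z) :: l) V (insert s(v, w) E) := by
  cases h with
  | cons _ _ V V' E E' h1 h2 hd =>
    cases h2 with
    | cons _ _ V1 V2 E1 E2 h3 h4 hd' =>
      have hd0 := hd
      rw [Finset.disjoint_union_right] at hd
      have hv := h1.mem.2
      have hw := h3.mem.1
      dsimp only at h1 h3 hv hw
      refine ⟨?_, ?_, ?_⟩
      · rintro rfl
        exact Finset.disjoint_left.mp hd.1 hv hw
      · simp only [Finset.mem_union, not_or]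
        refine ⟨fun he => ?_, fun he => ?_, fun he => ?_⟩
        · exact Finset.disjoint_left.mp hd.1 (h1.edge _ _ he).2 hw
        · exact Finset.disjoint_left.mp hd.1 hv (h3.edge _ _ he).1
        · exact Finset.disjoint_left.mp hd.2 hv (h4.edge _ _ he).1
      · have := Forest.cons (u, z) l _ _ _ _ (IsP.join _ _ _ _ _ _ _ _ h1 h3 hd.1) h4
          (Finset.disjoint_union_left.mpr ⟨hd.2, hd'⟩)
        rwa [Finset.union_assoc, Finset.insert_union, Finset.union_assoc] at this

theorem Forest.fresh {l : List (ℕ × ℕ)} {V : Finset ℕ} {E : Finset Edge} (h : Forest l V E)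
    {x : ℕ} (hx : x ∉ V) : Forest ((x, x) :: l) (insert x V) E := by
  have := Forest.cons (x, x) l _ _ _ _ (IsP.single x) h (by simpa using hx)
  simpa using this

/-! ### Abstract positions -/

/-- An abstract position: `nv` named vertices, `be` blue edges still to be drawn, at most `rh` red
edges still allowed, the end pairs `cs` of the blue components, and some red edges `rd`. -/
structure St where
  nv : ℕ
  be : ℕ
  rh : ℕ
  cs : List (ℕ × ℕ)
  rd : List (ℕ × ℕ)

/-- Builder wins from every concrete position that realises the abstract position `s`. -/
def Win (s : St) : Prop :=
  ∀ (n k : ℕ) (R : Set Edge) (V : Finset ℕ) (E : Finset Edge) (f : ℕ → ℕ),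
    Function.Injective f →
    ¬ HasCopy (SimpleGraph.cycleGraph 4) (SimpleGraph.fromEdgeSet R) →
    Forest (s.cs.map (Prod.map f f)) V E → (∀ i, s.nv ≤ i → f i ∉ V) →
    (∀ p ∈ s.rd, s(f p.1, f p.2) ∈ R) → E.card + s.be + 1 = n → s.be + s.rh ≤ k →
    CW n k R (E : Set Edge)

theorem hasCopy_C4 {R : Set Edge} {a b c d : ℕ} (hab : a ≠ b) (hac : a ≠ c) (had : a ≠ d)
    (hbc : b ≠ c) (hbd : b ≠ d) (hcd : c ≠ d) (h1 : s(a, b) ∈ R) (h2 : s(b, c) ∈ R)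
    (h3 : s(c, d) ∈ R) (h4 : s(d, a) ∈ R) :
    HasCopy (SimpleGraph.cycleGraph 4) (SimpleGraph.fromEdgeSet R) := by
  have h1' : s(b, a) ∈ R := by rwa [Sym2.eq_swap]
  have h2' : s(c, b) ∈ R := by rwa [Sym2.eq_swap]
  have h3' : s(d, c) ∈ R := by rwa [Sym2.eq_swap]
  have h4' : s(a, d) ∈ R := by rwa [Sym2.eq_swap]
  refine ⟨⟨![a, b, c, d], ?_⟩, ?_⟩
  · intro i j hij
    rw [SimpleGraph.cycleGraph_adj] at hij
    rw [SimpleGraph.fromEdgeSet_adj]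
    fin_cases i <;> fin_cases j <;> first
      | (exfalso; revert hij; decide)
      | (simp; tauto)
  · intro i j hij
    have hij' : (![a, b, c, d] : Fin 4 → ℕ) i = ![a, b, c, d] j := hij
    clear hij
    fin_cases i <;> fin_cases j <;> simp at hij' ⊢ <;> omega

theorem of_hasCopy_C4 {R : Set Edge}
    (h : HasCopy (SimpleGraph.cycleGraph 4) (SimpleGraph.fromEdgeSet R)) :
    ∃ a b c d : ℕ, a ≠ b ∧ a ≠ c ∧ a ≠ d ∧ b ≠ c ∧ b ≠ d ∧ c ≠ d ∧ s(a, b) ∈ R ∧ s(b, c) ∈ R ∧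
      s(c, d) ∈ R := by
  obtain ⟨f, hf⟩ := h
  have adj : ∀ i j : Fin 4, (SimpleGraph.cycleGraph 4).Adj i j → s(f i, f j) ∈ R := by
    intro i j hij
    exact ((SimpleGraph.fromEdgeSet_adj _).mp (f.map_adj hij)).1
  refine ⟨f 0, f 1, f 2, f 3, ?_, ?_, ?_, ?_, ?_, ?_, adj _ _ ?_, adj _ _ ?_, adj _ _ ?_⟩
  all_goals first
    | exact hf.ne (by decide)
    | (rw [SimpleGraph.cycleGraph_adj]; decide)

/-- `{a, b}` is listed in `l`. -/
def hasE (l : List (ℕ × ℕ)) (a b : ℕ) : Bool :=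
  l.any (fun p => (p.1 == a && p.2 == b) || (p.1 == b && p.2 == a))

theorem hasE_sound {l : List (ℕ × ℕ)} {a b : ℕ} (h : hasE l a b = true) {f : ℕ → ℕ} {R : Set Edge}
    (hl : ∀ p ∈ l, s(f p.1, f p.2) ∈ R) : s(f a, f b) ∈ R := by
  simp only [hasE, List.any_eq_true, Bool.or_eq_true, Bool.and_eq_true, beq_iff_eq] at h
  obtain ⟨p, hp, ⟨rfl, rfl⟩ | ⟨rfl, rfl⟩⟩ := h
  · exact hl p hp
  · rw [Sym2.eq_swap]; exact hl p hp

/-- The renaming of vertices described by a list; the vertices not in the list go to new ones. -/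
def ren (σ : List ℕ) (i : ℕ) : ℕ := σ.getD i (i + 16)

theorem ren_of_lt {σ : List ℕ} {i : ℕ} (h : i < σ.length) : ren σ i = σ[i] := by
  simp [ren, h]

theorem ren_of_ge {σ : List ℕ} {i : ℕ} (h : σ.length ≤ i) : ren σ i = i + 16 := by
  simp [ren, h]

theorem ren_injective {σ : List ℕ} (hn : σ.Nodup) (hlt : ∀ x ∈ σ, x < 16) :
    Function.Injective (ren σ) := by
  intro i j hij
  rcases lt_or_ge i σ.length with hi | hi <;> rcases lt_or_ge j σ.length with hj | hj
  · rw [ren_of_lt hi, ren_of_lt hj] at hij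
    exact (List.Nodup.getElem_inj_iff hn).mp hij
  · rw [ren_of_lt hi, ren_of_ge hj] at hij
    have := hlt _ (List.getElem_mem hi)
    omega
  · rw [ren_of_ge hi, ren_of_lt hj] at hij
    have := hlt _ (List.getElem_mem hj)
    omega
  · rw [ren_of_ge hi, ren_of_ge hj] at hij
    omega

/-- The position `s` is at least as good for Builder as `t`, as witnessed by the renaming `σ`. -/
def trans (s t : St) (σ : List ℕ) : Bool :=
  Nat.ble (s.nv + 2) 16 && (Nat.beq σ.length t.nv && (σ.all (fun x => Nat.ble (x + 1) (s.nv + 2)) &&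
    (decide σ.Nodup && (Nat.beq t.be s.be && (Nat.ble t.rh s.rh &&
    (matchC (t.cs.map (Prod.map (ren σ) (ren σ))) ((s.nv, s.nv) :: (s.nv + 1, s.nv + 1) :: s.cs) &&
    t.rd.all (fun p => hasE s.rd (ren σ p.1) (ren σ p.2))))))))

theorem trans_sound {s t : St} {σ : List ℕ} (h : trans s t σ = true) (ht : Win t) : Win s := by
  simp only [trans, Bool.and_eq_true, Nat.ble_eq, Nat.beq_eq, List.all_eq_true,
    decide_eq_true_eq] at h
  obtain ⟨h1, h2, h3, h4, h5, h6, h7, h8⟩ := h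
  intro n k R V E f hf hR hF hV hr hn hk
  have hF2 : Forest (((s.nv, s.nv) :: (s.nv + 1, s.nv + 1) :: s.cs).map (Prod.map f f))
      (insert (f s.nv) (insert (f (s.nv + 1)) V)) E := by
    have h0 := hF.fresh (hV (s.nv + 1) (by omega))
    refine h0.fresh (x := f s.nv) ?_
    rw [Finset.mem_insert, not_or]
    refine ⟨fun h => ?_, hV _ le_rfl⟩
    have := hf h
    omega
  obtain ⟨V', hV', hF'⟩ := hF2.of_matchC f h7
  refine ht n k R V' E (f ∘ ren σ)
    (hf.comp (ren_injective h4 (fun x hx => by have := h3 x hx; omega))) hR ?_ ?_ ?_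
    (by omega) (by omega)
  · rw [List.map_map, Prod.map_comp_map] at hF'
    exact hF'
  · intro i hi hmem
    rw [Function.comp, ren_of_ge (by omega)] at hmem
    have := hV' hmem
    simp only [Finset.mem_insert] at this
    rcases this with h | h | h
    · have := hf h; omega
    · have := hf h; omega
    · exact hV _ (by omega) h
  · intro p hp
    exact hasE_sound (h8 p hp) hr

/-- The position after the edge between the first two components has been coloured blue. -/
def blueSt (s : St) : St :=
  match s.cs with
  | p :: q :: l => ⟨s.nv, s.be - 1, s.rh, (p.1, q.2) :: l, s.rd⟩
  | _ => s

/-- The position after the edge between the first two components has been coloured red. -/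
def redSt (s : St) : St :=
  match s.cs with
  | p :: q :: _ => ⟨s.nv, s.be, s.rh - 1, s.cs, (p.2, q.1) :: s.rd⟩
  | _ => s

/-- The edge between the first two components would close the red cycle through `a`, `b`. -/
def forced (s : St) (a b : ℕ) : Bool :=
  match s.cs with
  | p :: q :: _ => (!Nat.beq a b && (!Nat.beq p.2 b && (!Nat.beq a q.1 &&
      (hasE s.rd p.2 a && (hasE s.rd a b && hasE s.rd b q.1)))))
  | _ => false

theorem edge_ne {l : List (ℕ × ℕ)} (hl : ∀ p ∈ l, p.1 ≠ p.2) {a b : ℕ}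
    (h : hasE l a b = true) : a ≠ b := by
  simp only [hasE, List.any_eq_true, Bool.or_eq_true, Bool.and_eq_true, beq_iff_eq] at h
  obtain ⟨p, hp, ⟨rfl, rfl⟩ | ⟨rfl, rfl⟩⟩ := h
  · exact hl p hp
  · exact (hl p hp).symm

theorem step_sound {s : St} (hc : 2 ≤ s.cs.length) (hb : 1 ≤ s.be) (hl : ∀ p ∈ s.rd, p.1 ≠ p.2)
    (hblue : Win (blueSt s))
    (hred : (∃ a b, forced s a b = true) ∨ (1 ≤ s.rh ∧ Win (redSt s))) : Win s := by
  obtain ⟨nv, be, rh, cs, rd⟩ := s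
  match cs, hc with
  | (u, v) :: (w, z) :: l, _ =>
  intro n k R V E f hf hR hF hV hr hn hk
  dsimp only [blueSt, redSt, forced] at *
  obtain ⟨hvw, hnE, hF'⟩ := Forest.join hF
  by_cases he : s(f v, f w) ∈ R
  · rcases hred with ⟨a, b, hab⟩ | ⟨hrh, hw⟩
    · exfalso
      simp only [Bool.and_eq_true, Bool.not_eq_true', ← Bool.not_eq_true, Nat.beq_eq] at hab
      obtain ⟨h1, h2, h3, h4, h5, h6⟩ := hab
      apply hR
      refine hasCopy_C4 (a := f v) (b := f a) (c := f b) (d := f w) ?_ ?_ ?_ ?_ ?_ ?_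
        (hasE_sound h4 hr) (hasE_sound h5 hr) (hasE_sound h6 hr) (by rwa [Sym2.eq_swap])
      · exact hf.ne (edge_ne hl h4)
      · exact hf.ne h2
      · exact hvw
      · exact hf.ne h1
      · exact hf.ne h3
      · exact hf.ne (edge_ne hl h6)
    · refine hw n k R V E f hf hR hF hV ?_ hn (by dsimp only; omega)
      intro p hp
      rcases List.mem_cons.mp hp with rfl | hp
      · exact he
      · exact hr p hp
  · obtain ⟨k, rfl⟩ : ∃ k', k = k' + 1 := ⟨k - 1, by omega⟩
    refine .step k R _ s(f v, f w) (by simpa using hvw) ?_ ?_ ?_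
    · simp only [Set.mem_union, not_or]
      exact ⟨he, by simpa using hnE⟩
    · have := hblue n k R V _ f hf hR hF' hV hr
        (by rw [Finset.card_insert_of_notMem hnE]; dsimp only; omega) (by dsimp only; omega)
      simpa using this
    · intro hC
      rcases hred with ⟨a, b, hab⟩ | ⟨hrh, hw⟩
      · exfalso
        simp only [Bool.and_eq_true, Bool.not_eq_true', ← Bool.not_eq_true, Nat.beq_eq] at hab
        obtain ⟨h1, h2, h3, h4, h5, h6⟩ := hab
        apply hC
        refine hasCopy_C4 (a := f v) (b := f a) (c := f b) (d := f w) ?_ ?_ ?_ ?_ ?_ ?_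
          (.inr (hasE_sound h4 hr)) (.inr (hasE_sound h5 hr)) (.inr (hasE_sound h6 hr))
          (.inl (by rw [Sym2.eq_swap]))
        · exact hf.ne (edge_ne hl h4)
        · exact hf.ne h2
        · exact hvw
        · exact hf.ne h1
        · exact hf.ne h3
        · exact hf.ne (edge_ne hl h6)
      · refine hw n k _ V E f hf hC hF hV ?_ hn (by dsimp only; omega)
        intro p hp
        rcases List.mem_cons.mp hp with rfl | hp
        · exact .inl rfl
        · exact .inr (hr p hp)

/-- The final position: a single blue path, no blue edge missing. -/
def final : St := ⟨2, 0, 0, [(0, 1)], []⟩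

theorem win_final : Win final := by
  intro n k R V E f hf hR hF hV hr hn hk
  dsimp only [final] at *
  refine .done k R _ (by rw [Set.ncard_coe_finset]; omega) ?_
  cases hF with
  | cons _ _ V V' E E' h1 h2 hd =>
    cases h2 with
    | nil =>
      rw [Finset.union_empty] at *
      exact h1.hasCopy (by omega)

/-! ### Certificates -/

/-- A certified position: the position, the renaming for the blue answer, and for the red answer
either a renaming or the two inner vertices of a red path that forbids it. -/
structure Nd where
  st : St
  bi : ℕ
  bs : List ℕ
  ri : ℕ
  rs : List ℕ

/-- Check a node, given the positions already known to be winning. -/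
def chk (known : List St) (d : Nd) : Bool :=
  Nat.ble 2 d.st.cs.length && (Nat.ble 1 d.st.be && (d.st.rd.all (fun p => !Nat.beq p.1 p.2) &&
    (trans (blueSt d.st) (known.getD d.bi final) d.bs &&
      match d.ri with
      | 0 => forced d.st (ren d.rs 0) (ren d.rs 1)
      | j + 1 => Nat.ble 1 d.st.rh && trans (redSt d.st) (known.getD j final) d.rs)))

theorem win_getD {known : List St} (h : ∀ s ∈ known, Win s) (i : ℕ) :
    Win (known.getD i final) := by
  rcases lt_or_ge i known.length with hi | hi
  · rw [List.getD_eq_getElem _ _ hi]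
    exact h _ (List.getElem_mem hi)
  · rw [List.getD_eq_default _ _ hi]
    exact win_final

theorem chk_sound {known : List St} {d : Nd} (hk : ∀ s ∈ known, Win s) (h : chk known d = true) :
    Win d.st := by
  simp only [chk, Bool.and_eq_true, Nat.ble_eq, List.all_eq_true] at h
  obtain ⟨h1, h2, h3, h4, h5⟩ := h
  refine step_sound h1 h2 ?_ (trans_sound h4 (win_getD hk _)) ?_
  · intro p hp
    have := h3 p hp
    simpa [← Bool.not_eq_true, Nat.beq_eq] using this
  · split at h5
    · exact .inl ⟨_, _, h5⟩
    · simp only [Bool.and_eq_true, Nat.ble_eq] at h5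
      exact .inr ⟨h5.1, trans_sound h5.2 (win_getD hk _)⟩

/-- Check a list of nodes; the known positions are accumulated in front. -/
def chkAll : List St → List Nd → Bool
  | _, [] => true
  | known, d :: l => chk known d && chkAll (d.st :: known) l

theorem chkAll_sound {l : List Nd} : ∀ {known : List St}, (∀ s ∈ known, Win s) →
    chkAll known l = true → ∀ d ∈ l, Win d.st := by
  induction l with
  | nil => simp
  | cons d l ih =>
    intro known hk h
    rw [chkAll, Bool.and_eq_true] at h
    have hd := chk_sound hk h.1
    have hk' : ∀ s ∈ d.st :: known, Win s := by
      intro s hs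
      rcases List.mem_cons.mp hs with rfl | hs
      · exact hd
      · exact hk s hs
    intro e he
    rcases List.mem_cons.mp he with rfl | he
    · exact hd
    · exact ih hk' h.2 e he

/-- Unpack a list of base 16 digits (least significant first, with a leading digit 1). -/
def unp : ℕ → ℕ → List ℕ
  | 0, _ => []
  | k + 1, x => bif Nat.ble x 1 then [] else (x % 16) :: unp k (x / 16)

/-- Unpack a list of pairs of base 16 digits. -/
def unpP : ℕ → ℕ → List (ℕ × ℕ)
  | 0, _ => []
  | k + 1, x => bif Nat.ble x 1 then [] else (x % 16, x / 16 % 16) :: unpP k (x / 256)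

/-- A node in packed form. -/
def nd (nv be rh cs rd bi bs ri rs : ℕ) : Nd :=
  ⟨⟨nv, be, rh, unpP 40 cs, unpP 40 rd⟩, bi, unp 40 bs, ri, unp 40 rs⟩

/-- Builder's strategy. Each position comes with the move joining its first two components; the
answers lead to earlier positions (given by how many steps back they are), up to renaming. -/
def cert : List Nd := [
  nd 4 1 1 17904128 19996976 0 304 0 275,
  nd 4 1 2 16790290 73744 1 306 1 70147,
  nd 3 1 3 73984 288 2 288 1 78112,
  nd 3 1 4 74241 1 3 289 1 4114,
  nd 5 1 0 16794401 5406535952 4 321 0 276,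
  nd 5 1 1 16790546 21115152 5 306 1 1323536,
  nd 5 1 2 16794131 82720 6 323 1 1250336,
  nd 5 1 3 16794386 320 7 322 1 1250336,
  nd 4 1 0 17904128 19996976 8 304 0 275,
  nd 4 1 1 17904128 78128 9 304 1 78337,
  nd 5 1 0 16782116 5423247392 10 276 0 320,
  nd 5 2 0 5420163584 5406531856 0 1196081 0 321,
  nd 5 2 1 4865405969 21111056 2 70432 1 1323536,
  nd 5 2 2 5420163584 82448 6 1196081 1 1323521,
  nd 5 2 3 4848632883 288 6 1184576 1 1183811,
  nd 3 2 4 74241 1 11 4882 1 1323026,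
  nd 4 1 2 78082 20062512 16 306 0 291,
  nd 4 1 3 73987 78385 17 291 1 70432,
  nd 4 1 1 78082 20062512 18 306 0 291,
  nd 4 1 2 74497 78112 19 289 1 77857,
  nd 4 1 0 78082 20062512 20 306 0 291,
  nd 4 1 1 74497 78112 21 289 1 77857,
  nd 6 2 1 21123856 5708665120 0 74757 0 325,
  nd 6 2 2 21107461 22303521 1 82513 1 22217026,
  nd 6 2 3 22167811 87123 6 87090 1 22294786,
  nd 5 2 1 21046016 5423374352 3 70658 0 322,
  nd 5 2 2 16786451 21180448 24 86816 1 1315616,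
  nd 4 1 1 16790290 73744 27 306 19 70147,
  nd 4 1 0 78082 20066592 28 306 0 306,
  nd 5 2 0 21107456 5423374352 0 73793 0 322,
  nd 5 2 1 16790546 21180448 2 86576 1 1315616,
  nd 6 3 1 5403391232 5708525584 0 1246241 0 321,
  nd 6 3 2 5403398912 22298896 5 1392673 1 22295056,
  nd 6 3 3 5405496576 82736 8 20185381 1 21176581,
  nd 5 3 4 16790546 320 18 4131 1 22102576,
  nd 6 4 3 5688599552 22102352 1 23089713 0 277,
  nd 6 4 4 5402285361 81968 1 1319248 1 20189701,
  nd 5 2 2 21049856 21185040 15 70659 12 1323536,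
  nd 5 2 3 18957315 78385 20 78356 1 1253636,
  nd 4 2 4 70402 306 35 5153 1 1323041,
  nd 5 3 4 20071425 78112 0 78116 7 22151956,
  nd 4 3 5 78082 306 25 5155 1 1323296,
  nd 5 2 1 18957056 21185040 20 70148 13 1319696,
  nd 7 3 1 5402289427 1530674683920 0 1455136 0 288,
  nd 7 3 2 5991645952 5978153488 20 23216389 1 374612752,
  nd 7 3 3 5707556353 22233681 20 22221862 1 356720902,
  nd 4 1 1 73987 78385 46 291 26 70432,
  nd 6 1 0 74805 1461651062832 47 293 0 337,
  nd 6 2 0 22225936 1461418340641 0 22163521 0 338,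
  nd 6 2 1 19943956 5691884113 2 79168 1 18961456,
  nd 6 3 1 5691805952 5708525904 0 22102786 0 325,
  nd 7 4 1 1460860433920 1534415945744 0 20992786 0 337,
  nd 7 4 2 1451984184884 5708525584 19 22291984 1 356722192,
  nd 6 4 3 5424419072 22298928 7 373493842 1 374616592,
  nd 6 4 4 5117072706 82720 19 1200432 1 20193616,
  nd 5 4 5 20005890 306 13 78356 1 22163476,
  nd 4 1 2 17900288 78096 56 288 47 78352,
  nd 4 1 3 17904128 272 57 304 1 74497,
  nd 5 2 3 4580197411 272 0 82704 45 1192976,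
  nd 6 3 3 4580197667 86288 0 1455120 27 19215376,
  nd 7 3 1 5117068837 1461954031648 29 1393424 0 304,
  nd 7 3 2 5975921152 5710757936 37 20317265 1 374616592,
  nd 7 4 2 1530401989120 5945511952 0 307258177 0 353,
  nd 7 4 3 1456279152194 22102032 3 22226448 1 340932097,
  nd 6 5 2 1460860433152 5690761488 11 374539297 0 289,
  nd 6 5 3 1387845997824 21111056 1 373306657 1 21176581,
  nd 5 5 4 5134959616 78096 29 22217281 1 22225156,
  nd 4 5 5 18952960 288 11 1318931 1 1319171,
  nd 4 2 1 17904128 5137047824 40 81969 0 305,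
  nd 4 2 2 18952960 18948112 22 66067 1 73987,
  nd 4 3 2 17904128 5119225872 0 82689 0 275,
  nd 4 3 3 17904128 19996944 56 1393409 1 74512,
  nd 4 3 4 18952960 73744 32 69667 1 73987,
  nd 3 3 5 73984 288 57 4866 1 78352,
  nd 3 3 6 74241 1 58 4882 1 4114,
  nd 5 1 0 16786451 5422194704 75 291 0 304,
  nd 6 2 0 5403391232 1461382619152 0 1180721 0 321,
  nd 6 3 0 1460860433152 1457106526480 0 20251666 0 337,
  nd 6 3 1 1245825750324 5405483280 65 1331728 1 20206096,
  nd 5 3 2 5134959616 19996688 52 1180481 1 22225156,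
  nd 4 3 3 17904128 78096 65 1393409 1 1323536,
  nd 5 4 3 4866520064 21111056 0 66322 0 289,
  nd 5 4 4 5134959616 78096 47 1253441 1 1253636,
  nd 4 4 5 18952960 288 41 73747 1 1319171,
  nd 3 4 6 74241 1 9 4882 1 77842,
  nd 3 5 6 74241 1 0 4882 18 77842,
  nd 5 1 0 78866 5423374352 86 306 0 288,
  nd 6 2 0 22225937 1461684609040 0 1265952 0 339,
  nd 6 3 0 5671826432 1461382623264 0 16921876 0 275,
  nd 6 3 1 5688607232 5707473216 46 1312049 1 22291201,
  nd 7 4 1 1387846001920 1530405204240 0 23331602 0 305,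
  nd 7 4 2 1460574119474 5691810064 58 21124624 1 356722192,
  nd 6 4 3 5421225216 21115152 46 370291717 1 373498117,
  nd 6 5 3 5688607232 5707473200 0 23332145 0 275,
  nd 6 5 4 5402285331 21176336 39 23343696 1 20189701,
  nd 5 5 5 16794131 81968 11 87088 1 22156336,
  nd 5 5 5 21115136 82720 40 1384515 2 22295056,
  nd 5 5 6 20005890 306 41 1389076 1 1191956,
  nd 5 6 4 4866520064 21111056 31 1377042 0 289,
  nd 5 6 5 5134959616 78096 3 1245761 1 1253636,
  nd 4 6 6 18952960 288 2 1318931 1 1319171,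
  nd 3 6 7 74241 1 15 4882 1 77842,
  nd 4 1 2 78353 20000800 102 305 0 259,
  nd 4 1 3 78610 73744 103 306 1 70192,
  nd 5 1 2 82451 21180448 104 323 83 82481,
  nd 7 2 1 22307618 392810481139760 83 83238 0 260,
  nd 7 2 2 22242852 1461382623264 1 1393505 1 356660752,
  nd 6 2 3 82725 5658202160 3 91457 1 371414017,
  nd 5 2 1 17908514 5387661328 80 86593 0 257,
  nd 5 2 2 20071441 19996688 4 1249856 1 1254416,
  nd 6 3 2 19026995 1315621126176 0 1455393 0 258,
  nd 6 3 3 21189922 5387661344 3 19150096 1 21189136,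
  nd 5 4 3 19022609 5422325776 0 22286896 0 288,
  nd 8 3 1 5997019664 411716979745393 63 22496816 0 359,
  nd 8 4 1 1603153301760 393025265156400 0 5691764834 0 339,
  nd 8 4 2 1525803939666 1457124421664 53 373498224 1 5975986439,
  nd 7 1 0 79174 392947670528016 116 310 0 354,
  nd 7 2 0 21062947 392956544688144 0 373495072 0 356,
  nd 7 2 1 22176787 1534986498080 71 87602 1 373625632,
  nd 6 2 0 21189137 1461684613152 98 79169 0 259,
  nd 7 3 0 5421294865 392956240539664 0 21369632 0 356,
  nd 7 3 1 5707556369 1461684609040 2 355734112 1 356722192,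
  nd 6 4 1 5688599552 1461382623264 0 369243412 0 275,
  nd 7 5 1 1456565470720 374260265791760 0 22294561 0 305,
  nd 7 5 2 1457102349824 1388653388064 8 6246376289 1 356720902,
  nd 6 5 3 4580201252 5708525872 12 1392899 1 371540752,
  nd 6 6 2 1460859319057 1457373913360 1 373510432 0 338,
  nd 6 6 3 1387845997824 5406535696 1 19940626 1 21176581,
  nd 5 7 3 1392140956416 5423378720 0 22217026 0 322,
  nd 5 7 4 1319126516736 20066592 30 1065521 1 1191956,
  nd 4 7 5 4866519808 74016 30 1311521 1 1318931,
  nd 3 7 6 17900032 272 30 77857 1 77842,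
  nd 2 7 7 69888 1 30 4609 1 4624,
  nd 4 1 2 78082 306 133 306 112 78112,
  nd 6 1 0 86820 1388653387792 134 340 0 272,
  nd 7 2 0 22176787 392887273594896 0 22226433 0 342,
  nd 7 2 1 21177622 1534968606752 114 78946 1 374424112,
  nd 7 2 2 23270437 5978140704 3 79201 1 342172432,
  nd 8 1 0 83543 105398443257700368 138 327 0 371,
  nd 8 2 0 22308658 105101716867850256 0 5742162689 0 342,
  nd 8 3 0 5711749905 105100612760317984 0 5454066224 0 373,
  nd 8 3 1 5694965265 393025800974368 22 342962768 1 6262501904,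
  nd 8 3 2 5140215636 1534433828880 4 325329264 1 5976170864,
  nd 7 4 2 5689656832 1534433841424 0 6191068454 0 337,
  nd 7 4 3 5691827713 5707551040 98 391332374 1 356720902,
  nd 6 5 3 5691805952 5707542816 0 371410177 0 306,
  nd 6 5 4 4848637236 21115152 91 23216464 1 19141381,
  nd 6 6 4 5688607232 5707473200 0 23332145 0 275,
  nd 6 6 5 5402285331 21176336 51 1323600 1 20189701,
  nd 5 6 6 16794131 81968 63 4148 1 22156336,
  nd 5 6 6 21115136 82720 52 1384515 2 22295056,
  nd 5 6 7 20005890 306 53 1389076 1 1191956,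
  nd 5 7 5 4866520064 21111056 52 1377042 0 289,
  nd 5 7 6 5134959616 78096 3 1245761 1 1253636,
  nd 4 7 7 18952960 288 2 1318931 1 1319171,
  nd 3 7 8 74241 1 53 4882 1 77842,
  nd 7 3 3 23286292 5996036144 117 1533251 14 6280057904,
  nd 6 1 0 74805 1461113143312 157 293 0 257,
  nd 7 2 0 21124627 389443227820048 0 20075536 0 288,
  nd 7 2 1 23286292 1457124421664 112 79174 1 337007392,
  nd 8 3 1 6247621905 410549266497584 0 376517664 0 371,
  nd 8 4 1 1535251723025 411575460646928 0 5963584544 0 336,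
  nd 8 4 2 1525284960069 1534664458256 129 23410450 1 5993886224,
  nd 7 4 3 5424440849 5708525584 6 340865632 1 6262302224,
  nd 6 5 3 5402285331 5138096144 0 372393217 40 373498117,
  nd 6 6 3 5688607232 1461382619440 0 23397185 0 275,
  nd 6 6 4 5687493137 5708525872 19 23336240 1 22295056,
  nd 9 1 0 92277 26833717076048289808 167 357 0 305,
  nd 9 2 0 24524869 28212065745196097552 0 95952584992 0 338,
  nd 9 2 1 25392454 110204472471396368 122 100195 1 105048715792,
  nd 6 1 0 75060 1461382623264 170 292 0 321,
  nd 8 2 0 24528179 104552983493173312 0 20407328 0 279,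
  nd 9 3 0 6243375158 28212327493636542528 0 5742469384 0 353,
  nd 9 3 1 5961320519 105400633135284272 3 100482056452 1 100483147792,
  nd 8 4 1 5993867025 105364495281430544 0 104238113287 0 304,
  nd 8 5 1 1594809738240 104801477431734560 0 4838356244 0 370,
  nd 8 5 2 1315887413076 392947668426768 60 6499344752 1 5960242439,
  nd 7 6 2 1461952057600 392814792950064 0 6242198354 0 323,
  nd 7 6 3 1383264708179 1388653388064 52 21177872 1 339026272,
  nd 6 7 3 1460859319057 1457373913360 0 373510432 0 338,
  nd 6 7 4 1387845997824 5406535696 13 19940626 1 21176581,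
  nd 5 7 5 4580197411 19996688 81 1389584 1 22164481,
  nd 4 8 5 5152837888 20066592 0 1311011 0 306,
  nd 4 8 6 4866519808 74016 29 1311521 1 73747,
  nd 3 8 7 17900032 272 29 77857 1 77842,
  nd 2 8 8 69888 1 29 4609 1 4624,
  nd 5 6 5 16782371 21180448 118 86800 0 304,
  nd 6 7 5 5705376512 5658194256 0 1070113 0 277,
  nd 6 7 6 4848637236 20983840 38 1196368 1 20193541,
  nd 5 7 7 21115136 81968 37 1392675 1 22098976,
  nd 6 2 3 22287106 86850 56 82513 167 20251681,
  nd 5 2 2 21176576 82736 57 77890 161 1323296,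
  nd 5 1 1 17904674 18956304 192 306 0 257,
  nd 6 1 0 17900597 5658193936 193 293 0 272,
  nd 7 2 0 5688608290 1534664458256 0 19219216 0 337,
  nd 7 2 1 4866524725 5924540432 2 1393168 1 325403152,
  nd 5 1 0 16782371 21180448 196 275 0 304,
  nd 6 2 0 5705376512 5658194256 0 1070113 0 277,
  nd 7 3 0 1460860433920 1534684381456 0 22283026 0 337,
  nd 7 3 1 1451984184899 5708525840 3 324411412 1 356722192,
  nd 6 3 2 5402277137 22294800 8 1250336 1 373633552,
  nd 6 3 3 5405496576 82720 10 21114901 1 21176581,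
  nd 5 3 4 20005890 306 162 78356 1 22163476,
  nd 6 2 1 22233617 5707477024 181 79124 0 259,
  nd 6 2 2 21124371 21176336 70 82725 1 20189776,
  nd 5 2 3 82451 81968 101 86848 1 22156336,
  nd 5 2 2 20071425 78385 72 78116 164 1253636,
  nd 5 1 0 78881 5422329888 207 305 0 304,
  nd 6 2 0 22282771 1461686776385 0 1331970 0 340,
  nd 6 2 1 21058051 5709710162 162 83249 1 22164481,
  nd 5 1 0 70691 5422329888 210 275 0 304,
  nd 6 2 0 21116177 1457087655952 0 1315616 0 304,
  nd 6 3 0 5705376512 1461417226512 0 22037011 0 321,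
  nd 6 3 1 5421225216 5422329888 3 20055061 1 21176581,
  nd 5 3 2 21107456 21115424 7 1385473 1 22291216,
  nd 5 3 3 17843250 78385 9 1122371 1 1184516,
  nd 5 4 3 21107456 21185056 0 1385473 0 322,
  nd 5 4 4 17843235 78385 14 1381124 1 1249796,
  nd 5 5 4 21107456 21185056 0 1385473 0 322,
  nd 5 5 5 17843235 78385 163 1381124 1 1249796,
  nd 5 6 5 21107456 21185056 0 1385473 0 322,
  nd 5 6 6 17843235 78385 123 1381124 1 1249796,
  nd 5 7 6 21046016 21185056 0 1384513 0 322,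
  nd 5 7 7 19940370 78385 71 1389060 1 1253636,
  nd 4 7 8 70402 306 122 5153 1 1323521,
  nd 5 8 6 4866520064 21111056 71 1377042 0 289,
  nd 5 8 7 5134959616 78096 36 1245761 1 1253636,
  nd 4 8 8 18952960 288 2 73747 1 1319171,
  nd 3 8 9 74241 1 72 4882 1 77842,
  nd 7 3 2 21194018 391783715446800 24 24404768 0 304,
  nd 7 4 2 5958161425 392956258369584 0 290677252 0 259,
  nd 7 4 3 5671839284 1461683564576 29 24461921 1 356722192,
  nd 6 4 4 20075796 5423374352 29 1455141 1 373498192,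
  nd 7 4 3 20010022 1534968672288 17 1533233 0 304,
  nd 3 1 2 73984 288 234 288 207 78112,
  nd 5 2 0 5420163584 5406535952 38 1196801 0 321,
  nd 5 2 1 5133845521 19996976 189 70436 1 1253396,
  nd 4 2 2 16790290 73744 2 4656 1 1315331,
  nd 5 1 0 74771 5405548560 238 291 0 288,
  nd 6 2 0 20071697 1452792684560 0 1323296 0 288,
  nd 6 2 1 21189137 5691748368 218 82709 1 22168336,
  nd 5 1 0 74771 5423374352 241 291 0 288,
  nd 6 2 0 21177617 1457122258976 0 1315616 0 308,
  nd 7 3 0 5421291025 390680178405392 0 21304096 0 304,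
  nd 7 3 1 5134968389 1452792684560 3 22226448 1 356722192,
  nd 6 3 2 17912612 5658193936 7 91217 1 371479312,
  nd 6 3 1 5134963712 5658194256 215 1069857 0 277,
  nd 6 2 0 22233601 1461418348864 226 87089 0 340,
  nd 7 3 0 5942363392 392951980105744 0 16990502 0 355,
  nd 7 4 0 1530403098880 392878949032272 0 370168882 0 357,
  nd 7 4 1 1383264708179 1461382619456 3 21116432 1 356720992,
  nd 6 4 2 5402285361 5422194704 5 18957571 1 373498117,
  nd 7 5 2 5973824290 392874636161040 0 24532001 0 257,
  nd 7 5 3 5691827729 1461382619152 19 340988512 1 356722192,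
  nd 6 5 4 21189137 5708525584 21 23351600 1 374612752,
  nd 6 6 4 5402285331 5138096144 0 20071681 77 373498117,
  nd 6 7 4 5688607232 1461382619440 0 23397185 0 275,
  nd 6 7 5 5117072676 5422194704 70 1323344 1 21176581,
  nd 5 7 6 21115136 21180448 36 1377060 1 22295056,
  nd 4 1 0 78353 20000800 259 305 0 259,
  nd 4 1 1 78610 73744 260 306 1 70192,
  nd 5 2 1 74771 5423374352 0 86820 0 288,
  nd 7 3 1 20079892 392956277301264 0 1324581 0 288,
  nd 7 3 2 23405587 1534986498080 56 1529394 1 374608672,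
  nd 5 2 1 18957056 21185056 217 74753 0 322,
  nd 7 1 0 87620 390679908917264 265 340 0 305,
  nd 7 2 0 21255731 391848428384272 0 355737697 0 272,
  nd 7 3 0 4866528820 392956258369584 0 340923907 0 320,
  nd 7 3 1 5705393699 1461684613152 3 1393505 1 356720992,
  nd 7 4 1 5974930705 392956240539664 0 390468384 0 356,
  nd 7 4 2 5691827729 1461684609040 6 355734112 1 356722192,
  nd 6 5 2 5671826432 1461382623264 0 369243412 0 275,
  nd 6 5 3 5688607232 5708521776 179 23285825 1 22291216,
  nd 6 5 4 5133849876 21180448 218 23282256 1 21172741,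
  nd 6 6 4 5117072676 5422194704 0 23343440 109 21176581,
  nd 5 7 4 5420163584 5406535952 0 22167601 0 321,
  nd 5 7 5 4580197411 19996944 176 1389584 1 1192976,
  nd 5 8 5 4866520064 5405483280 0 1377042 0 289,
  nd 5 8 6 5134959616 19996688 19 1180481 1 1253636,
  nd 4 9 6 5152837888 20066592 0 1314866 0 306,
  nd 4 9 7 4866519808 74016 53 1311521 1 73747,
  nd 3 9 8 17900032 272 53 77857 1 77842,
  nd 2 9 9 69888 1 53 4609 1 4624,
  nd 6 8 5 5705380352 1448497717584 25 23089985 0 277,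
  nd 6 8 6 5419062546 5371863056 95 23282256 1 17974021,
  nd 5 8 7 21176576 20983840 61 1377090 1 22294816,
  nd 5 8 8 21115136 81968 61 81955 1 1250336,
  nd 5 7 6 21107456 21185056 65 1385473 0 322,
  nd 5 7 7 17843235 78385 136 1381124 1 1249796,
  nd 5 8 7 21046016 21185056 0 1384513 0 322,
  nd 5 8 8 19940370 78385 65 78340 1 1253636,
  nd 4 8 9 70402 306 135 5153 1 1323521,
  nd 5 9 7 4866520064 21111056 65 1377042 0 289,
  nd 5 9 8 5134959616 78096 6 1245761 1 1253636,
  nd 4 9 9 18952960 288 2 73747 1 1319171,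
  nd 3 9 10 74241 1 66 4882 1 77842,
  nd 5 6 5 21046016 21185056 76 1384513 0 322,
  nd 5 6 6 19940370 78385 199 1389060 1 1253636,
  nd 4 7 6 18952960 73744 0 1311011 22 1315331,
  nd 5 8 6 16786451 5422194704 0 86576 0 304,
  nd 5 8 7 21115136 21180448 11 1377060 1 1323536,
  nd 5 8 5 4866523904 5405548816 119 1377298 0 289,
  nd 5 8 6 5134959616 19996944 113 22163521 1 1253636,
  nd 5 9 6 4866520064 5405483280 0 1388562 0 289,
  nd 5 9 7 5134959616 19996688 3 1180481 1 1253636,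
  nd 4 10 7 5152837888 20066592 0 1314866 0 306,
  nd 4 10 8 4866519808 74016 12 1311521 1 73747,
  nd 3 10 9 17900032 272 12 77857 1 77842,
  nd 2 10 10 69888 1 12 4609 1 4624,
  nd 6 9 6 5705380352 1448497717584 9 1069889 0 277,
  nd 6 9 7 5419062546 5371863056 24 1323600 1 17974021,
  nd 5 9 8 21176576 20983840 20 1377090 1 22294816,
  nd 5 9 9 21115136 81968 20 81955 1 1250336,
  nd 4 8 6 17900288 20062480 14 82433 0 289,
  nd 4 8 7 18952960 74000 25 1315331 1 73987,
  nd 3 8 8 74241 272 159 4882 1 78082,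
  nd 4 9 8 78082 20062512 0 5155 0 291,
  nd 4 9 9 74497 78112 88 5138 1 77857,
  nd 4 9 10 78082 306 2 5155 1 78112,
  nd 5 10 8 4866520064 21111056 25 1377042 0 289,
  nd 5 10 9 5134959616 78096 7 1245761 1 1253636,
  nd 4 10 10 18952960 288 2 73747 1 1319171,
  nd 3 10 11 74241 1 26 4882 1 77842,
  nd 7 7 6 20010022 1534968672288 101 1533233 0 304,
  nd 7 7 7 23270437 5996036144 172 1533233 1 374489872,
  nd 7 6 5 20010022 1534968672288 105 1533233 0 304,
  nd 7 6 6 23270437 5996036144 228 1533233 1 374489872,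
  nd 7 4 4 22308387 1457104429072 124 1528646 235 24462118,
  nd 6 5 4 22168337 1461683564576 0 370418947 0 258,
  nd 6 5 5 20075796 5423374352 273 1455141 1 21176656,
  nd 7 6 5 23155762 392956546785296 0 24531472 0 357,
  nd 9 2 1 100182 7221207969268589731856 70 104071 0 356,
  nd 9 3 1 24532024 7222293354439691542544 0 92465803792 0 376,
  nd 9 3 2 22296679 28063165692966412304 128 26506552 1 104812786192,
  nd 9 3 3 25523254 110203381817090064 127 1672566 1 104747782432,
  nd 9 3 4 25589044 430486221561872 128 1672820 1 105015230992,
  nd 4 1 3 78337 1 336 305 203 73777,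
  nd 10 2 3 22321270 408548046610448 0 87145 0 275,
  nd 5 1 1 78882 21045264 338 306 0 272,
  nd 9 1 0 88167 27991142042055024656 339 343 0 322,
  nd 9 2 0 24471620 28211518120201891856 0 99964059952 0 370,
  nd 9 2 1 21264485 109038853492387856 2 1528850 1 104812786192,
  nd 10 3 1 6261262441 28216849858263326736 0 92228752928 0 370,
  nd 10 3 2 6848472901 114986386785902608 151 1672787 1 1737186685456,
  nd 10 3 3 5993896312 430400322215952 6 1471181713696 1 1681030156816,
  nd 10 4 3 6848407380 115008389684215824 0 1827613648129 0 408,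
  nd 10 4 4 6848403015 449251538718736 10 109392836097 1 1754299445776,
  nd 9 3 2 24532024 28212065813646098448 140 1672566 0 354,
  nd 9 3 3 25577269 110168188587683856 142 1460306 1 101035885057,
  nd 10 3 2 26756695 29442110362878033952 142 1742964 0 305,
  nd 8 1 0 83543 105398443258748944 350 327 0 371,
  nd 8 2 0 22181428 105400715043745808 0 6262252304 0 373,
  nd 8 2 1 23229748 411721541955600 305 91970 1 6264406529,
  nd 9 3 0 6262326818 28212383650351755280 213 5763121936 0 389,
  nd 9 3 1 6261213254 105400784030605328 1 6280128528 1 100483147792,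
  nd 10 4 1 6819185971 6909711732386837905424 0 112584127504 0 294,
  nd 10 4 2 6532929331 26991061518793130000 6 1346578444576 1 1754080227856,
  nd 10 4 3 6852858931 110218903832059920 8 108321399312 1 1737437360656,
  nd 10 1 0 92281 7537041241650551136272 358 361 0 405,
  nd 10 2 0 25466455 7537113581888065314832 0 1754299445776 0 408,
  nd 10 2 1 25532230 29442148919084654608 313 100709 1 1753544471056,
  nd 10 1 0 104566 7535887986101373181968 361 406 0 340,
  nd 10 2 0 25590101 7534744106980393164816 0 1475426722561 0 327,
  nd 10 3 0 6529697641 7536041707516116148240 0 1689335062816 0 393,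
  nd 10 3 1 6247651672 28212348465979662352 3 1616091747586 1 1616590901536,
  nd 9 3 2 25507399 110187030876594192 158 1672563 1 1750304370976,
  nd 9 4 2 6566397218 110203442216124432 0 99430446337 0 391,
  nd 10 5 2 1749749549090 29365605316803252240 0 109293421328 0 371,
  nd 10 5 3 1535252859170 115008393124597776 10 1273012435216 1 1681854309136,
  nd 10 5 4 1607447255432 411721541955600 22 1607730370576 1 1607730370576,
  nd 9 6 4 5710772258 109622900076658704 0 1826022048528 0 343,
  nd 7 2 1 87604 389580417216528 110 95314 0 272,
  nd 7 3 1 21124627 391852990734352 0 306402817 0 288,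
  nd 7 3 2 21190162 1530407301152 168 24335398 1 374424112,
  nd 7 4 1 5973816610 374260247900176 129 392438544 0 321,
  nd 7 4 2 5691827729 1388653387792 1 324280672 1 356722192,
  nd 6 5 2 5403398912 1461684609312 0 373302547 0 274,
  nd 6 5 3 5402285331 5423374352 160 1323600 1 21176581,
  nd 7 6 3 5653947442 392888095744016 0 24531472 0 342,
  nd 9 7 3 1607729316625 28212382473530720304 0 406943314 0 260,
  nd 9 7 4 1535217076276 105400779434700832 9 95906070832 1 100483146112,
  nd 8 7 5 5997019665 411721811443760 50 391517232 1 105064317712,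
  nd 8 7 6 5942376261 1534987546656 55 374548240 1 5993865584,
  nd 7 8 6 5139154432 1534969659936 0 6207853334 0 338,
  nd 7 8 7 5673870913 5691884113 59 353576452 1 355603462,
  nd 6 9 6 5688599552 1388653388048 85 1385217 0 305,
  nd 6 9 7 5405496576 5138096144 1 371262517 1 21176581,
  nd 5 10 7 5420163584 5406535696 0 22225921 0 321,
  nd 5 11 7 1392140956416 5423378720 0 1245506 0 322,
  nd 5 11 8 1319126516736 20066592 69 1065521 1 1191956,
  nd 4 11 9 4866519808 74016 69 1311521 1 1318931,
  nd 3 11 10 17900032 272 69 77857 1 77842,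
  nd 2 11 11 69888 1 69 4609 1 4624,
  nd 5 9 6 4866523904 5405548816 114 1392673 0 289,
  nd 5 9 7 5134959616 19996944 108 1253441 1 1253636,
  nd 4 9 8 18952960 73744 104 1311011 1 1319171,
  nd 5 10 8 16786451 5422194704 0 86576 0 304,
  nd 5 10 9 16794386 20983840 1 87072 1 1126976,
  nd 5 10 10 21115136 81968 79 81955 1 1250336,
  nd 6 3 1 17847331 1457123381568 137 1381124 0 309,
  nd 6 3 2 18961411 5691888193 138 1385236 1 21311506,
  nd 6 1 0 82725 1461684609040 401 325 0 272,
  nd 7 2 0 20071702 390748914655248 0 23274497 0 288,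
  nd 7 2 1 23286292 1534433832992 381 79429 1 370430512,
  nd 8 1 0 95828 105398443258748944 404 372 0 371,
  nd 8 2 0 24454708 105400715009146928 0 6262251779 0 320,
  nd 8 3 0 6246512145 105400715009146928 0 4650910214 0 373,
  nd 8 3 1 6247621905 411721540911152 3 376517664 1 6280196624,
  nd 8 2 0 22246978 104835561754271760 273 22491664 0 311,
  nd 8 3 0 6262252305 100614605602107424 0 5926889219 0 258,
  nd 8 4 0 1388651312640 105101716867920160 0 6207853334 0 306,
  nd 8 4 1 1534125438786 391852739150096 3 5689972484 1 5741101424,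
  nd 7 4 2 5706376723 1457123369280 11 22295046 1 6262239254,
  nd 6 4 3 21058051 5709709873 197 1463105 1 374489872,
  nd 5 2 0 21107456 5422334224 327 1115171 0 321,
  nd 5 2 1 20005890 20062512 368 74516 1 1253636,
  nd 5 3 1 18957056 5423382800 0 1381408 0 321,
  nd 5 3 2 20071425 20066608 210 1389076 1 1253636,
  nd 5 4 2 21046016 5423309072 0 1381378 0 321,
  nd 6 5 2 5670712337 1461684609296 0 1266192 0 339,
  nd 6 5 3 5138109696 5423374352 6 19137301 1 21176581,
  nd 5 6 3 5420163584 5405557008 0 22164481 0 321,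
  nd 5 6 4 5134959616 19996976 148 22032961 1 1253636,
  nd 4 6 5 16790290 73744 355 82480 1 1315331,
  nd 4 7 5 17900288 20062480 0 81953 0 289,
  nd 4 7 6 18952960 74000 203 1315331 1 73987,
  nd 3 7 7 74241 272 324 4882 1 78082,
  nd 4 8 7 78353 20000800 0 5139 0 259,
  nd 4 8 8 78610 73744 272 5155 1 70192,
  nd 4 9 8 74513 20062224 0 82208 0 288,
  nd 5 10 8 16794131 5422334224 0 78849 0 308,
  nd 5 10 9 16794401 21115152 136 86336 1 1254416,
  nd 5 10 10 20071425 78112 113 78116 1 1253636,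
  nd 4 10 11 78082 306 137 5155 1 1323296,
  nd 5 11 9 4866520064 21111056 113 1377042 0 289,
  nd 5 11 10 5134959616 78096 36 1245761 1 1253636,
  nd 4 11 11 18952960 288 2 73747 1 1319171,
  nd 3 11 12 74241 1 114 4882 1 77842,
  nd 7 8 7 20010022 1534968672288 149 1533233 0 304,
  nd 7 8 8 23270437 5996036144 214 91441 1 374489872,
  nd 7 8 7 5424358912 5996041008 115 319111702 0 339,
  nd 9 4 4 24479814 100614467627327504 238 1660536 349 26572360,
  nd 8 5 4 24470579 105363254055878672 0 105014239552 0 293,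
  nd 8 5 5 22312758 392809963143184 387 1594951 1 5992903184,
  nd 7 6 5 23344418 392810482196528 0 6212169749 0 276,
  nd 7 2 2 19031363 5944459280 210 5682 0 272,
  nd 7 3 1 5974938385 1530388365360 403 1335634 0 260,
  nd 7 3 2 5403403829 5691748384 1 337993987 1 356720992,
  nd 6 3 3 21189906 21180448 242 1254480 1 373371472,
  nd 6 4 3 22283041 5709709873 0 23351555 0 340,
  nd 8 2 1 23286823 411716961775632 428 90997 42 6213223184,
  nd 8 2 2 24458788 1535254806544 317 95315 1 5946819344,
  nd 8 1 1 95828 408345933586448 452 372 102 5997080864,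
  nd 8 2 0 24532018 105400784048435216 242 1406500 0 272,
  nd 8 2 1 20080453 411721541955600 1 5992772609 1 6280196624,
  nd 9 1 0 100197 28211784412487032848 455 389 0 388,
  nd 9 2 0 25646659 28212348465979662352 0 105045705232 0 391,
  nd 9 3 0 6564308258 28212065883170881552 0 79046128897 0 391,
  nd 9 3 1 6547527458 109921975829348368 3 6042239760 1 104812786192,
  nd 9 3 2 5707565159 411716961775632 7 5759009296 1 100231489552,
  nd 7 1 1 91444 392809963134992 460 356 374 1401666,
  nd 8 1 0 83543 26982019001750724624 461 327 0 371,
  nd 8 2 0 24470308 26982019001750724624 0 6280196624 0 272,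
  nd 8 2 1 21124663 105398442719780880 2 338121473 1 6028538384,
  nd 8 1 0 91988 105380850533736464 464 356 0 355,
  nd 8 2 0 24531748 105398442719780880 0 6028538384 0 272,
  nd 9 3 0 5981296418 28202811155554578448 0 4924519425 0 387,
  nd 9 3 1 6266577698 109904451825909776 3 6545687809 1 104810758672,
  nd 8 2 0 21132883 105399546240122896 310 24392208 0 372,
  nd 9 3 0 6565348898 28211766751027798032 0 6565409281 0 304,
  nd 9 4 0 1676432012305 28135522354167103536 0 104774988292 0 259,
  nd 9 4 1 1603668117556 105100613043433504 3 95906070832 1 100483084672,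
  nd 8 4 2 5975930661 391784003870736 12 104760170242 1 104778109552,
  nd 7 5 2 5993796352 392951982342416 0 6196045379 0 321,
  nd 7 5 3 5706376723 1461684674880 24 22294566 1 356659222,
  nd 8 6 3 6279090705 105400715042697248 0 410407700 0 259,
  nd 8 6 4 5993756451 392956544688144 106 1753792911136 1 5993865584,
  nd 8 7 4 6247560465 105400784031658016 0 6564483872 0 372,
  nd 8 7 5 5957048100 411721543008304 33 342176112 1 6277120784,
  nd 8 7 6 5673940806 1534986498080 152 358819600 1 5993865584,
  nd 8 8 6 6228567329 411716979749473 0 6550536965 0 327,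
  nd 8 9 6 1462224687360 411721542091056 0 5426794754 0 323,
  nd 8 9 7 1315618977606 1534969659936 41 374548240 1 5992759559,
  nd 7 9 8 5673870913 5691884113 43 353576452 1 6261183494,
  nd 4 8 7 18952960 73744 260 1311011 182 1319171,
  nd 5 9 7 16786451 5422194704 0 86576 0 304,
  nd 6 10 7 5688599552 1388653388048 0 1385217 0 305,
  nd 6 10 8 5405496576 5138096144 3 371262517 1 21176581,
  nd 5 11 8 5420163584 5406535696 0 22225921 0 321,
  nd 5 11 9 4580197411 19996688 168 1389584 1 1192961,
  nd 4 12 9 5152837888 20066592 0 1311011 0 306,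
  nd 4 12 10 4866519808 74016 55 1311521 1 73747,
  nd 3 12 11 17900032 272 55 77857 1 77842,
  nd 2 12 12 69888 1 55 4609 1 4624]

/-- The initial position `b`. -/
def rootB (n : ℕ) : St := ⟨2, n - 2, n - 1, [(0, 1)], []⟩

/-- Where the initial positions `b` are found. -/
def tabB : List (ℕ × ℕ) :=
  [(85, 4609), (101, 4609), (155, 4609), (228, 4609), (295, 4609), (322, 4609), (437, 4609)]

/-- The initial position `br`. -/
def rootBr (n : ℕ) : St := ⟨3, n - 2, n - 2, [(0, 1), (2, 2)], [(1, 2)]⟩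

/-- Where the initial positions `br` are found. -/
def tabBr : List (ℕ × ℕ) :=
  [(67, 78082), (100, 78082), (154, 78082), (227, 78082), (294, 78082), (321, 78082), (436, 78082)]

/-- The initial position `brb`. -/
def rootBrb (n : ℕ) : St := ⟨4, n - 3, n - 2, [(0, 1), (2, 3)], [(1, 2)]⟩

/-- Where the initial positions `brb` are found. -/
def tabBrb : List (ℕ × ℕ) :=
  [(55, 1319216), (97, 1319216), (151, 1319216), (224, 74032), (291, 74032), (318, 74032), (433, 74032)]

/-- The initial position `brr`. -/
def rootBrr (n : ℕ) : St := ⟨4, n - 2, n - 3, [(0, 1), (2, 2), (3, 3)], [(1, 2), (2, 3)]⟩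

/-- Where the initial positions `brr` are found. -/
def tabBrr : List (ℕ × ℕ) :=
  [(66, 1314851), (99, 1314851), (153, 1314851), (226, 1314851), (293, 1314851), (320, 1314851), (435, 1314851)]

/-- The initial position `brrb`. -/
def rootBrrb (n : ℕ) : St := ⟨5, n - 3, n - 3, [(0, 1), (2, 2), (3, 4)], [(1, 2), (2, 3)]⟩

/-- Where the initial positions `brrb` are found. -/
def tabBrrb : List (ℕ × ℕ) :=
  [(36, 22221826), (95, 1250306), (149, 1250306), (189, 1250306), (286, 1250306), (312, 1250306), (398, 1250306)]

/-- The initial position `empty`. -/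
def rootE (n : ℕ) : St := ⟨0, n - 1, n - 1, [], []⟩

/-- Where the initial positions `empty` are found. -/
def tabE : List (ℕ × ℕ) :=
  [(132, 272), (185, 272), (282, 272), (308, 272), (392, 272), (493, 272)]

/-- Check that the positions `r n`, `r (n + 1)`, … are covered by known positions. -/
def chkR (known : List St) (r : ℕ → St) : ℕ → List (ℕ × ℕ) → Bool
  | _, [] => true
  | n, c :: t => trans (r n) (known.getD c.1 final) (unp 40 c.2) && chkR known r (n + 1) t

theorem chkR_sound {known : List St} (hk : ∀ s ∈ known, Win s) (r : ℕ → St) :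
    ∀ (l : List (ℕ × ℕ)) (n : ℕ), chkR known r n l = true →
      ∀ m, n ≤ m → m < n + l.length → Win (r m) := by
  intro l
  induction l with
  | nil => intro n _ m h1 h2; simp at h2; omega
  | cons c t ih =>
    intro n h m h1 h2
    rw [chkR, Bool.and_eq_true] at h
    rcases Nat.eq_or_lt_of_le h1 with rfl | h1
    · exact trans_sound h.1 (win_getD hk _)
    · exact ih (n + 1) h.2 m h1 (by simp at h2; omega)

/-- The positions of the certificate. -/
def certSt : List St := cert.map Nd.st

theorem cert_ok : chkAll [] cert = true := by decide +kernel

theorem roots_ok : chkR certSt rootB 7 tabB = true ∧ chkR certSt rootBr 7 tabBr = true ∧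
    chkR certSt rootBrb 7 tabBrb = true ∧ chkR certSt rootBrr 7 tabBrr = true ∧
    chkR certSt rootBrrb 7 tabBrrb = true ∧ chkR certSt rootE 8 tabE = true := by decide +kernel

theorem win_certSt : ∀ s ∈ certSt, Win s := by
  intro s hs
  obtain ⟨d, hd, rfl⟩ := List.mem_map.mp hs
  exact chkAll_sound (by simp) cert_ok d hd

theorem rrwin_of_win {n : ℕ} {s : St} {V : Finset ℕ} {E : Finset Edge} (R : Finset Edge)
    (hs : Win s) (hF : Forest s.cs V E) (hV : ∀ i, s.nv ≤ i → i ∉ V)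
    (hr : ∀ p ∈ s.rd, s(p.1, p.2) ∈ R) (hE : E.card + s.be + 1 = n)
    (hk : s.be + s.rh + (R.card + E.card) ≤ 2 * n - 2) (hR : R.card ≤ 2) :
    RRWin n (R : Set Edge) (E : Set Edge) := by
  have hc : ((R : Set Edge) ∪ (E : Set Edge)).ncard ≤ R.card + E.card := by
    refine (Set.ncard_union_le _ _).trans ?_
    simp
  refine rrwin_of_CW R.finite_toSet E.finite_toSet (by omega) ?_
  refine hs n _ _ V E id Function.injective_id ?_ (by simpa using hF) (by simpa using hV)
    (by simpa using hr) hE (by omega)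
  intro hC
  obtain ⟨a, b, c, d, hab, hac, had, hbc, hbd, hcd, h1, h2, h3⟩ := of_hasCopy_C4 hC
  have h3c : ({s(a, b), s(b, c), s(c, d)} : Finset Edge) ⊆ R := by
    intro e he
    simp only [Finset.mem_insert, Finset.mem_singleton] at he
    rcases he with rfl | rfl | rfl <;> assumption
  have := Finset.card_le_card h3c
  rw [Finset.card_eq_three.mpr ⟨s(a, b), s(b, c), s(c, d), ?_, ?_, ?_, rfl⟩] at this
  · omega
  · simp only [ne_eq, Sym2.eq_iff]; omega
  · simp only [ne_eq, Sym2.eq_iff]; omega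
  · simp only [ne_eq, Sym2.eq_iff]; omega

/-- For every `7 ≤ n ≤ 13`, Builder has a winning strategy in `RR(C₄, Pₙ, H)` when
`H` is a `b`-path, a `br`-path, a `brb`-path, a `brr`-path, or a `brrb`-path;
furthermore for every `8 ≤ n ≤ 13` Builder has a winning strategy in
`RR(C₄, Pₙ, ∅)`. -/
theorem RR_win_small_n :
    (∀ n : ℕ, 7 ≤ n → n ≤ 13 →
      -- `b`-path
      RRWin n ∅ {s(0, 1)} ∧
      -- `br`-path
      RRWin n {s(1, 2)} {s(0, 1)} ∧
      -- `brb`-path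
      RRWin n {s(1, 2)} {s(0, 1), s(2, 3)} ∧
      -- `brr`-path
      RRWin n {s(1, 2), s(2, 3)} {s(0, 1)} ∧
      -- `brrb`-path
      RRWin n {s(1, 2), s(2, 3)} {s(0, 1), s(3, 4)}) ∧
    (∀ n : ℕ, 8 ≤ n → n ≤ 13 → RRWin n ∅ ∅) := by
  constructor
  · intro n h7 h13
    obtain ⟨c1, c2, c3, c4, c5, -⟩ := roots_ok
    have w1 := chkR_sound win_certSt _ _ _ c1 n h7 (by simp [tabB]; omega)
    have w2 := chkR_sound win_certSt _ _ _ c2 n h7 (by simp [tabBr]; omega)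
    have w3 := chkR_sound win_certSt _ _ _ c3 n h7 (by simp [tabBrb]; omega)
    have w4 := chkR_sound win_certSt _ _ _ c4 n h7 (by simp [tabBrr]; omega)
    have w5 := chkR_sound win_certSt _ _ _ c5 n h7 (by simp [tabBrrb]; omega)
    have f0 := Forest.nil
    refine ⟨?_, ?_, ?_, ?_, ?_⟩
    · have f1 := (((f0.fresh (x := 1) (by simp)).fresh (x := 0) (by simp)).join).2.2
      have := rrwin_of_win (n := n) ∅ w1 f1 (by simp [rootB]; omega) (by simp [rootB])
        (by simp [rootB]; omega) (by simp [rootB]; omega) (by simp)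
      simpa using this
    · have f1 := ((((f0.fresh (x := 2) (by simp)).fresh (x := 1) (by simp)).fresh (x := 0)
        (by simp)).join).2.2
      have := rrwin_of_win (n := n) {s(1, 2)} w2 f1 (by simp [rootBr]; omega) (by simp [rootBr])
        (by simp [rootBr]; omega) (by simp [rootBr]; omega) (by simp)
      simpa using this
    · have f1 := (((f0.fresh (x := 3) (by simp)).fresh (x := 2) (by simp)).join).2.2
      have f2 := (((f1.fresh (x := 1) (by simp)).fresh (x := 0) (by simp)).join).2.2
      have := rrwin_of_win (n := n) {s(1, 2)} w3 f2 (by simp [rootBrb]; omega) (by simp [rootBrb])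
        (by simp [rootBrb]; omega) (by simp [rootBrb]; omega) (by simp)
      simpa using this
    · have f1 := (((((f0.fresh (x := 3) (by simp)).fresh (x := 2) (by simp)).fresh (x := 1)
        (by simp)).fresh (x := 0) (by simp)).join).2.2
      have := rrwin_of_win (n := n) {s(1, 2), s(2, 3)} w4 f1 (by simp [rootBrr]; omega) (by simp [rootBrr])
        (by simp [rootBrr]; omega) (by simp [rootBrr]; omega) (by simp)
      simpa using this
    · have f1 := (((f0.fresh (x := 4) (by simp)).fresh (x := 3) (by simp)).join).2.2
      have f2 := ((((f1.fresh (x := 2) (by simp)).fresh (x := 1) (by simp)).fresh (x := 0)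
        (by simp)).join).2.2
      have := rrwin_of_win (n := n) {s(1, 2), s(2, 3)} w5 f2 (by simp [rootBrrb]; omega) (by simp [rootBrrb])
        (by simp [rootBrrb]; omega) (by simp [rootBrrb]; omega) (by simp)
      simpa using this
  · intro n h8 h13
    have w := chkR_sound win_certSt _ _ _ roots_ok.2.2.2.2.2 n h8 (by simp [tabE]; omega)
    have := rrwin_of_win (n := n) ∅ w Forest.nil (by simp) (by simp [rootE])
      (by simp [rootE]; omega) (by simp [rootE]; omega) (by simp)
    simpa using this

end OnlineRamsey
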